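/- Let d ≥ 1 and l, r, R ∈ ℕ. Let v : ℤ^d → ℝ satisfy v(x) ≥ 1_{{0}}(x) for all x and supp v ⊂ Λ_r, let α : ℤ^d → ℝ be finitely supported, set u(x) := Σ_{k∈ℤ^d} α_k v(x−k) and assume supp u ⊂ Λ_R. Let V_per : ℤ^d → ℝ be bounded, let (ω_k)_{k∈ℤ^d} be independent, identically distributed bounded real random variables with a compactly supported density f of bounded variation, set V_ω(x) := Σ_{k∈ℤ^d} ω_k u(x−k), and let H_ω^l be the compression of −Δ + V_per + V_ω to ℓ²(Q_l). Let I = [E₁,E₂]. Suppose there exists an invertible matrix A_Λ indexed by Q_{l+R} × Q_{l+R} such that A_Λ(j,k) = α_{j−k} for all j ∈ Q_{l+r} and all k ∈ Q_{l+R}, and let B_Λ be its inverse. Then for every j ∈ Q_l and every φ ∈ ℓ²(Q_l) with ‖φ‖ = 1, E{ ⟨φ, χ_j P_ω^l(I) χ_j φ⟩ } ≤ (E₂ − E₁) · ‖f‖_BV · ‖B_Λ‖₁, where χ_j is multiplication by the indicator function of {j} and P_ω^l(I) is the spectral projection of H_ω^l onto I. -/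

import Mathlib

open MeasureTheory Matrix

noncomputable section

/-- The discrete cube `Q_s = {-s,…,s}^d ⊂ ℤ^d`, as a type. -/
abbrev DCube (d s : ℕ) := Fin d → (Set.Icc (-(s : ℤ)) (s : ℤ))

/-- Inclusion of the cube into `ℤ^d`. -/
def DCube.emb {d s : ℕ} (m : DCube d s) : Fin d → ℤ := fun i => (m i : ℤ)

/-- Matrix of the compression of the negative discrete Laplacian `-Δ` to `ℓ²(Q_l)`,
where `(Δφ)(k) = ∑_i (φ(k+e_i) + φ(k-e_i))`. -/
def negLap (d l : ℕ) : Matrix (DCube d l) (DCube d l) ℂ := fun j k =>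
  -(∑ i : Fin d,
      ((if k.emb = j.emb + Pi.single i 1 then (1 : ℂ) else 0) +
        (if k.emb = j.emb - Pi.single i 1 then (1 : ℂ) else 0)))

/-- Matrix of the compression of `-Δ + V` to `ℓ²(Q_l)`. -/
def schrodinger (d l : ℕ) (V : (Fin d → ℤ) → ℝ) : Matrix (DCube d l) (DCube d l) ℂ :=
  negLap d l + Matrix.diagonal fun j => (V j.emb : ℂ)

/-- The spectral projection of a Hermitian matrix onto the set `I ⊆ ℝ`. -/
def specProj {n : Type*} [Fintype n] [DecidableEq n] {M : Matrix n n ℂ}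
    (hM : M.IsHermitian) (I : Set ℝ) : Matrix n n ℂ :=
  (hM.eigenvectorUnitary : Matrix n n ℂ) *
    Matrix.diagonal (fun i => Set.indicator I (fun _ => (1 : ℂ)) (hM.eigenvalues i)) *
    star (hM.eigenvectorUnitary : Matrix n n ℂ)

/-- Multiplication by the indicator function of the site `j`, as a matrix. -/
def chi {n : Type*} [Fintype n] [DecidableEq n] (j : n) : Matrix n n ℂ :=
  Matrix.diagonal fun q => if q = j then (1 : ℂ) else 0

lemma Matrix.IsHermitian.sub_ofReal_diagonal {n : Type*} [DecidableEq n] {T : Matrix n n ℂ}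
    (hT : T.IsHermitian) (g : n → ℝ) : (T - diagonal fun k => (g k : ℂ)).IsHermitian :=
  hT.sub (isHermitian_diagonal_of_self_adjoint _ (funext fun k => Complex.conj_ofReal (g k)))

section Dissipative
variable {n : Type*} [Fintype n] [DecidableEq n]

lemma Matrix.IsHermitian.dotProduct_sub_diagonal_im {T : Matrix n n ℂ} (hT : T.IsHermitian)
    (g : n → ℝ) (x : n → ℂ) :
    (star x ⬝ᵥ ((T - diagonal fun k => Complex.I * (g k : ℂ)) *ᵥ x)).im
      = -∑ k, g k * ‖x k‖ ^ 2 := by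
  have h1 : (star x ⬝ᵥ (T *ᵥ x)).im = 0 := by
    have := hT.im_star_dotProduct_mulVec_self x
    simpa using this
  rw [sub_mulVec, dotProduct_sub, Complex.sub_im, h1, zero_sub, neg_inj, dotProduct, Complex.im_sum]
  refine Finset.sum_congr rfl fun k _ => ?_
  rw [mulVec_diagonal, Pi.star_apply]
  have : star (x k) * (Complex.I * (g k : ℂ) * x k) = Complex.I * ((g k * ‖x k‖ ^ 2 : ℝ) : ℂ) := by
    have h := Complex.conj_mul' (x k)
    push_cast
    rw [← h]
    simp only [Complex.star_def]
    ring
  rw [this, Complex.I_mul_im, Complex.ofReal_re]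

lemma Matrix.IsHermitian.isUnit_det_sub_diagonal {T : Matrix n n ℂ} (hT : T.IsHermitian)
    {g : n → ℝ} (hg : ∀ k, 0 < g k) :
    IsUnit (T - diagonal fun k => Complex.I * (g k : ℂ)).det := by
  rw [isUnit_iff_ne_zero]
  intro h0
  obtain ⟨x, hx, hMx⟩ := exists_mulVec_eq_zero_iff.2 h0
  have h := hT.dotProduct_sub_diagonal_im g x
  rw [hMx, dotProduct_zero, Complex.zero_im, eq_comm, neg_eq_zero,
    Finset.sum_eq_zero_iff_of_nonneg fun k _ => mul_nonneg (hg k).le (sq_nonneg _)] at h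
  refine hx (funext fun k => ?_)
  have := h k (Finset.mem_univ k)
  simpa [(hg k).ne'] using this

lemma Matrix.IsHermitian.inv_sub_diagonal_im {T : Matrix n n ℂ} (hT : T.IsHermitian)
    {g : n → ℝ} (hg : ∀ k, 0 < g k) (j : n) :
    0 ≤ ((T - diagonal fun k => Complex.I * (g k : ℂ))⁻¹ j j).im ∧
      ((T - diagonal fun k => Complex.I * (g k : ℂ))⁻¹ j j).im ≤ (g j)⁻¹ := by
  set M := T - diagonal fun k => Complex.I * (g k : ℂ) with hM
  have hdet : IsUnit M.det := hT.isUnit_det_sub_diagonal hg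
  set x : n → ℂ := M⁻¹ *ᵥ Pi.single j 1 with hx
  have hxj : x j = M⁻¹ j j := by simp [hx]
  have hMx : M *ᵥ x = Pi.single j 1 := by
    rw [hx, mulVec_mulVec, mul_nonsing_inv _ hdet, one_mulVec]
  have h := hT.dotProduct_sub_diagonal_im g x
  rw [← hM, hMx] at h
  simp only [dotProduct_single, Pi.star_apply, mul_one, Complex.star_def, Complex.conj_im,
    neg_inj] at h
  rw [← hxj]
  have hnn : ∀ k, 0 ≤ g k * ‖x k‖ ^ 2 := fun k => mul_nonneg (hg k).le (sq_nonneg _)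
  have h0 : 0 ≤ (x j).im := h ▸ Finset.sum_nonneg fun k _ => hnn k
  refine ⟨h0, ?_⟩
  have h1 : g j * ‖x j‖ ^ 2 ≤ (x j).im :=
    h ▸ Finset.single_le_sum (f := fun k => g k * ‖x k‖ ^ 2) (fun k _ => hnn k) (Finset.mem_univ j)
  have h2 : (x j).im ≤ ‖x j‖ := (le_abs_self _).trans (Complex.abs_im_le_norm _)
  have h3 : g j * (x j).im ^ 2 ≤ (x j).im :=
    le_trans (mul_le_mul_of_nonneg_left (by gcongr) (hg j).le) h1
  rw [← one_div, le_div_iff₀ (hg j)]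
  rcases h0.eq_or_lt with h4 | h4
  · rw [← h4]; simp
  · refine le_of_mul_le_mul_right ?_ h4
    nlinarith

lemma DifferentiableAt.matrix_det {A : ℂ → Matrix n n ℂ} {z : ℂ}
    (hA : ∀ i k, DifferentiableAt ℂ (fun w => A w i k) z) :
    DifferentiableAt ℂ (fun w => (A w).det) z := by
  simp only [det_apply]
  fun_prop

lemma DifferentiableAt.matrix_inv_apply {A : ℂ → Matrix n n ℂ} {z : ℂ}
    (hA : ∀ i k, DifferentiableAt ℂ (fun w => A w i k) z) (hz : IsUnit (A z).det) (i j : n) :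
    DifferentiableAt ℂ (fun w => (A w)⁻¹ i j) z := by
  simp only [inv_def, Ring.inverse_eq_inv', Matrix.smul_apply, smul_eq_mul, adjugate_apply]
  refine ((DifferentiableAt.matrix_det hA).inv hz.ne_zero).mul (DifferentiableAt.matrix_det ?_)
  intro a b
  by_cases h : a = j
  · subst h; simp
  · simpa [updateRow_ne h] using hA a b

lemma Continuous.matrix_inv_apply {X : Type*} [TopologicalSpace X] {A : X → Matrix n n ℂ}
    (hA : Continuous A) (hu : ∀ x, IsUnit (A x).det) (i j : n) :
    Continuous fun x => (A x)⁻¹ i j := by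
  simp only [inv_def, Ring.inverse_eq_inv', Matrix.smul_apply, smul_eq_mul]
  exact (hA.matrix_det.inv₀ fun x => (hu x).ne_zero).mul (hA.matrix_adjugate.matrix_elem i j)

/-- The mean value property at the centre of the unit disc, transported to the boundary line of a
half plane by the Cayley transform. -/
lemma lintegral_poisson_of_differentiableAt {f : ℂ → ℂ}
    (hf : ∀ z ∈ Metric.closedBall (0 : ℂ) 1, DifferentiableAt ℂ f z)
    (hpos : ∀ z ∈ Metric.closedBall (0 : ℂ) 1, 0 ≤ (f z).im) {Y : ℝ} (hY : 0 < Y) :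
    ∫⁻ t : ℝ, ENNReal.ofReal (2 * Y / (Y ^ 2 + t ^ 2)) *
        ENNReal.ofReal (f (-((Y + Complex.I * t) / (Y - Complex.I * t)))).im
      = ENNReal.ofReal (2 * Real.pi * (f 0).im) := by
  have hcont : Continuous fun θ : ℝ => f (circleMap 0 1 θ) := by
    rw [continuous_iff_continuousAt]
    intro θ
    exact ContinuousAt.comp (f := fun θ : ℝ => circleMap 0 1 θ) (g := f)
      (hf _ (by simp)).continuousAt (continuous_circleMap 0 1).continuousAt
  have havg := circleAverage_of_differentiable_on_off_countable (f := f) (c := 0) (R := 1)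
    Set.countable_empty (fun z hz => (hf z (by simpa using hz)).continuousAt.continuousWithinAt)
    (fun z hz => hf z (by have := hz.1; simp at this ⊢; exact this.le))
  rw [Real.circleAverage_def] at havg
  have him : ∫ θ in (0 : ℝ)..2 * Real.pi, (f (circleMap 0 1 θ)).im = 2 * Real.pi * (f 0).im := by
    have h1 := Complex.imCLM.intervalIntegral_comp_comm
      (hcont.intervalIntegrable (μ := volume) 0 (2 * Real.pi))
    simp only [Complex.imCLM_apply] at h1
    rw [h1, ← havg, Complex.smul_im, smul_eq_mul, mul_inv_cancel_left₀ (by positivity)]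
  set p : ℝ → ℝ := fun t => Real.pi + 2 * Real.arctan (t / Y) with hp
  have hderiv : ∀ t ∈ Set.univ, HasDerivWithinAt p (2 * Y / (Y ^ 2 + t ^ 2)) Set.univ t := by
    intro t _
    rw [hasDerivWithinAt_univ]
    have := (((hasDerivAt_id t).div_const Y).arctan.const_mul 2).const_add Real.pi
    convert this using 1
    · simp [hp, id]
    · simp only [id]
      field_simp
  have hinj : Set.InjOn p Set.univ := by
    intro a _ b _ hab
    simp only [hp, add_right_inj, mul_eq_mul_left_iff, OfNat.ofNat_ne_zero, or_false,
      Real.arctan_inj] at hab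
    field_simp at hab
    exact hab
  have himg : p '' Set.univ = Set.Ioo 0 (2 * Real.pi) := by
    ext θ
    simp only [Set.image_univ, Set.mem_range, Set.mem_Ioo]
    constructor
    · rintro ⟨t, rfl⟩
      have h1 := Real.neg_pi_div_two_lt_arctan (t / Y)
      have h2 := Real.arctan_lt_pi_div_two (t / Y)
      constructor <;> simp only [hp] <;> linarith
    · rintro ⟨h1, h2⟩
      refine ⟨Y * Real.tan ((θ - Real.pi) / 2), ?_⟩
      simp only [hp]
      rw [mul_div_cancel_left₀ _ hY.ne', Real.arctan_tan (by linarith) (by linarith)]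
      ring
  have key := lintegral_image_eq_lintegral_abs_deriv_mul MeasurableSet.univ hderiv hinj
    fun θ => ENNReal.ofReal (f (circleMap 0 1 θ)).im
  rw [himg, Measure.restrict_univ] at key
  have hcm : ∀ t : ℝ, circleMap 0 1 (p t) = -((Y + Complex.I * t) / (Y - Complex.I * t)) := by
    intro t
    have hne : (Y : ℂ) - Complex.I * t ≠ 0 := by
      intro h
      have := congrArg Complex.re h
      simp at this
      exact hY.ne' this
    have ht : (t : ℂ) * Complex.cos (Real.arctan (t / Y))
        = Y * Complex.sin (Real.arctan (t / Y)) := by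
      have h1 := Real.tan_arctan (t / Y)
      have hc := (Real.cos_arctan_pos (t / Y)).ne'
      rw [Real.tan_eq_sin_div_cos, div_eq_div_iff hc hY.ne'] at h1
      rw [← Complex.ofReal_cos, ← Complex.ofReal_sin]
      exact_mod_cast (by linarith : t * Real.cos (Real.arctan (t / Y))
        = Y * Real.sin (Real.arctan (t / Y)))
    have hexp : circleMap 0 1 (p t) = -(Complex.cos (Real.arctan (t / Y))
        + Complex.sin (Real.arctan (t / Y)) * Complex.I) ^ 2 := by
      rw [← Complex.exp_mul_I, ← Complex.exp_nat_mul, circleMap, hp, zero_add, Complex.ofReal_one,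
        one_mul, Complex.ofReal_add, add_mul, Complex.exp_add, Complex.exp_pi_mul_I, neg_one_mul]
      push_cast
      ring_nf
    have hcs := Complex.cos_sq_add_sin_sq (Real.arctan (t / Y))
    rw [hexp, neg_inj, eq_div_iff hne]
    set c := Complex.cos (Real.arctan (t / Y))
    set s := Complex.sin (Real.arctan (t / Y))
    have hI := Complex.I_sq
    linear_combination (Y : ℂ) * hcs + Complex.I * t * hcs + (2 * s - 2 * c * Complex.I) * ht
      + (-2 * c * s * t + s ^ 2 * Y - s ^ 2 * Complex.I * t) * hI
  calc _ = ∫⁻ t : ℝ, ENNReal.ofReal |2 * Y / (Y ^ 2 + t ^ 2)| *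
        ENNReal.ofReal (f (circleMap 0 1 (p t))).im := by
        refine lintegral_congr fun t => ?_
        rw [hcm, abs_of_nonneg (by positivity)]
    _ = ∫⁻ θ in Set.Ioo 0 (2 * Real.pi), ENNReal.ofReal (f (circleMap 0 1 θ)).im := key.symm
    _ = _ := by
        rw [← him, intervalIntegral.integral_of_le (by positivity), restrict_Ioo_eq_restrict_Ioc,
          ofReal_integral_eq_lintegral_ofReal]
        · exact ((Complex.continuous_im.comp hcont).integrableOn_Ioc)
        · exact Filter.Eventually.of_forall fun θ => hpos _ (by simp)

lemma lintegral_poisson_inv_le {T : Matrix n n ℂ} (hT : T.IsHermitian) {W : n → ℝ}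
    (hW : ∀ k, 0 < W k) {ε : ℝ} (hε : 0 < ε) (j : n) {Y : ℝ} (hY : 0 < Y) :
    ∫⁻ t : ℝ, ENNReal.ofReal (Y ^ 2 / (Y ^ 2 + t ^ 2)) * ENNReal.ofReal
        ((T - diagonal (fun k => ((t * W k : ℝ) : ℂ)) -
          diagonal fun _ => Complex.I * (ε : ℂ) : Matrix n n ℂ)⁻¹ j j).im
      ≤ ENNReal.ofReal (Real.pi / W j) := by
  set A : ℂ → Matrix n n ℂ := fun w => (1 - w) • (T - diagonal fun _ => Complex.I * (ε : ℂ)) -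
    (1 + w) • diagonal fun k => Complex.I * ((Y * W k : ℝ) : ℂ) with hA
  -- the resolvent at the image of `w ≠ 1` under the Cayley transform
  have hAz : ∀ w : ℂ, ‖w‖ ≤ 1 → w ≠ 1 → ∃ (a : n → ℝ) (g : n → ℝ), (∀ k, 0 < g k) ∧
      A w = (1 - w) • ((T - diagonal fun k => (a k : ℂ)) -
        diagonal fun k => Complex.I * (g k : ℂ)) := by
    intro w hw hw1
    have h1w : (1 - w) ≠ 0 := sub_ne_zero.2 hw1.symm
    set q : ℂ := (1 + w) / (1 - w) with hq
    have hqre : 0 ≤ q.re := by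
      have h1 : q.re = (1 - Complex.normSq w) / Complex.normSq (1 - w) := by
        rw [hq, Complex.div_re, ← add_div]
        congr 1
        simp [Complex.normSq_apply]
        ring
      rw [h1]
      refine div_nonneg ?_ (Complex.normSq_nonneg _)
      rw [Complex.normSq_eq_norm_sq]
      nlinarith [norm_nonneg w]
    refine ⟨fun k => -q.im * (Y * W k), fun k => ε + q.re * (Y * W k), fun k => ?_, ?_⟩
    · have := hW k
      positivity
    · have h2 : (1 + w) = (1 - w) * q := by rw [hq, mul_div_cancel₀ _ h1w]
      simp only [hA]
      rw [h2, mul_smul, ← smul_sub]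
      congr 1
      ext a b
      by_cases hab : a = b
      · subst hab
        simp only [Matrix.sub_apply, Matrix.smul_apply, diagonal_apply_eq, smul_eq_mul]
        refine Complex.ext (by simp) ?_
        simp
        ring
      · simp [hab]
  have hunit : ∀ w : ℂ, ‖w‖ ≤ 1 → IsUnit (A w).det := by
    intro w hw
    by_cases hw1 : w = 1
    · have : A w = diagonal fun k => -2 * (Complex.I * ((Y * W k : ℝ) : ℂ)) := by
        subst hw1
        ext a b
        by_cases hab : a = b
        · subst hab
          simp only [hA, Matrix.sub_apply, Matrix.smul_apply, diagonal_apply_eq, smul_eq_mul]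
          ring
        · simp [hA, hab]
      rw [this, det_diagonal, isUnit_iff_ne_zero]
      refine Finset.prod_ne_zero_iff.2 fun k _ => ?_
      have := hW k
      have h1 : Y * W k ≠ 0 := by positivity
      simpa using h1
    · obtain ⟨a, g, hg, h⟩ := hAz w hw hw1
      rw [h, det_smul]
      exact ((sub_ne_zero.2 (Ne.symm hw1)).isUnit.pow _).mul
        ((hT.sub_ofReal_diagonal a).isUnit_det_sub_diagonal hg)
  set f : ℂ → ℂ := fun w => (1 - w) * (A w)⁻¹ j j with hf
  have hfz : ∀ (w : ℂ) (M : Matrix n n ℂ), w ≠ 1 → A w = (1 - w) • M → f w = M⁻¹ j j := by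
    intro w M hw h
    have h1w : (1 - w) ≠ 0 := sub_ne_zero.2 hw.symm
    simp only [hf]
    rw [h]
    by_cases hM : IsUnit M.det
    · let _ := invertibleOfNonzero h1w
      rw [inv_smul M (1 - w) hM, Matrix.smul_apply, smul_eq_mul, mul_invOf_cancel_left']
    · have hM' : ¬ IsUnit ((1 - w) • M).det := by
        rw [det_smul]
        exact fun hu => hM (isUnit_of_mul_isUnit_right hu)
      rw [nonsing_inv_apply_not_isUnit _ hM, nonsing_inv_apply_not_isUnit _ hM']
      simp
  have hpos : ∀ z ∈ Metric.closedBall (0 : ℂ) 1, 0 ≤ (f z).im := by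
    intro w hw
    by_cases hw1 : w = 1
    · simp [hf, hw1]
    · obtain ⟨a, g, hg, h⟩ := hAz w (by simpa using hw) hw1
      rw [hfz w _ hw1 h]
      exact ((hT.sub_ofReal_diagonal a).inv_sub_diagonal_im hg j).1
  have hdiff : ∀ z ∈ Metric.closedBall (0 : ℂ) 1, DifferentiableAt ℂ f z := by
    intro w hw
    refine DifferentiableAt.mul (by fun_prop) (DifferentiableAt.matrix_inv_apply (fun i k => ?_)
      (hunit w (by simpa using hw)) j j)
    simp only [hA, Matrix.sub_apply, Matrix.smul_apply, smul_eq_mul]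
    fun_prop
  have hmain := lintegral_poisson_of_differentiableAt hdiff hpos hY
  have h0 : f 0 = (T - diagonal fun k => Complex.I * ((ε + Y * W k : ℝ) : ℂ))⁻¹ j j := by
    refine hfz 0 _ zero_ne_one ?_
    ext a b
    by_cases hab : a = b
    · subst hab
      simp [hA]
      ring
    · simp [hA, hab]
  have h0le : (f 0).im ≤ (Y * W j)⁻¹ := by
    rw [h0]
    refine ((hT.inv_sub_diagonal_im (fun k => ?_) j).2).trans ?_
    · have := hW k
      positivity
    · have := hW j
      gcongr
      linarith
  have hft : ∀ t : ℝ, f (-((Y + Complex.I * t) / (Y - Complex.I * t))) =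
      (T - diagonal (fun k => ((t * W k : ℝ) : ℂ)) -
        diagonal fun _ => Complex.I * (ε : ℂ) : Matrix n n ℂ)⁻¹ j j := by
    intro t
    have hne : (Y : ℂ) - Complex.I * t ≠ 0 := by
      intro h
      have := congrArg Complex.re h
      simp at this
      exact hY.ne' this
    have hY' : (Y : ℂ) ≠ 0 := by exact_mod_cast hY.ne'
    have h1 : 1 - -((Y + Complex.I * t) / (Y - Complex.I * t)) = 2 * Y / (Y - Complex.I * t) := by
      field_simp
      ring
    have h2 : (1 + -((Y + Complex.I * t) / (Y - Complex.I * t))) * Complex.I * Y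
        = 2 * Y / (Y - Complex.I * t) * t := by
      field_simp
      linear_combination (-2 * t : ℂ) * Complex.I_sq
    refine hfz _ _ ?_ ?_
    · intro h
      rw [h, sub_self, eq_comm, div_eq_zero_iff] at h1
      rcases h1 with h1 | h1
      · exact hY' (by simpa using h1)
      · exact hne h1
    · ext a b
      by_cases hab : a = b
      · subst hab
        simp only [hA, Matrix.sub_apply, Matrix.smul_apply, diagonal_apply_eq, smul_eq_mul]
        push_cast
        rw [h1]
        linear_combination (-W a : ℂ) * h2
      · simp [hA, hab]
  have hscale : ∀ t : ℝ, ENNReal.ofReal (Y ^ 2 / (Y ^ 2 + t ^ 2)) =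
      ENNReal.ofReal (Y / 2) * ENNReal.ofReal (2 * Y / (Y ^ 2 + t ^ 2)) := by
    intro t
    rw [← ENNReal.ofReal_mul (by positivity)]
    congr 1
    ring
  simp only [hft] at hmain
  simp only [hscale, mul_assoc]
  rw [lintegral_const_mul' _ _ ENNReal.ofReal_ne_top, hmain,
    ← ENNReal.ofReal_mul (by positivity)]
  refine ENNReal.ofReal_le_ofReal ?_
  have := hW j
  calc Y / 2 * (2 * Real.pi * (f 0).im) = Real.pi * Y * (f 0).im := by ring
    _ ≤ Real.pi * Y * (Y * W j)⁻¹ := by gcongr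
    _ = Real.pi / W j := by field_simp

/-- **Spectral averaging**: the integrals of a diagonal matrix element of the resolvent are uniformly
bounded when the matrix is perturbed along a nonnegative potential. -/
lemma lintegral_inv_sub_smul_le {T : Matrix n n ℂ} (hT : T.IsHermitian) {W : n → ℝ}
    (hW : ∀ k, 0 ≤ W k) {ε : ℝ} (hε : 0 < ε) {j : n} (hj : 1 ≤ W j) :
    ∫⁻ t : ℝ, ENNReal.ofReal
        ((T - diagonal (fun k => ((t * W k : ℝ) : ℂ)) -
          diagonal fun _ => Complex.I * (ε : ℂ) : Matrix n n ℂ)⁻¹ j j).im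
      ≤ ENNReal.ofReal Real.pi := by
  set Φ : ℝ → ℝ → ENNReal := fun δ t => ENNReal.ofReal (1 / (1 + (t * δ) ^ 2)) * ENNReal.ofReal
        ((T - diagonal (fun k => ((t * (W k + δ) : ℝ) : ℂ)) -
          diagonal fun _ => Complex.I * (ε : ℂ) : Matrix n n ℂ)⁻¹ j j).im with hΦ
  have hcont : Continuous fun p : ℝ × ℝ => Φ p.1 p.2 := by
    have h1 : Continuous fun p : ℝ × ℝ =>
        ((T - diagonal (fun k => ((p.2 * (W k + p.1) : ℝ) : ℂ)) -
          diagonal fun _ => Complex.I * (ε : ℂ) : Matrix n n ℂ)⁻¹ j j) := by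
      refine Continuous.matrix_inv_apply ?_ (fun p => ?_) j j
      · exact (continuous_const.sub (Continuous.matrix_diagonal (by fun_prop))).sub continuous_const
      · exact (hT.sub_ofReal_diagonal _).isUnit_det_sub_diagonal fun _ => hε
    have h2 : Continuous fun p : ℝ × ℝ => 1 / (1 + (p.2 * p.1) ^ 2) :=
      continuous_const.div (by fun_prop) fun p => by positivity
    have h3 := ENNReal.continuous_ofReal.comp (h2.mul (Complex.continuous_im.comp h1))
    refine h3.congr fun p => ?_
    exact ENNReal.ofReal_mul (by positivity)
  set δ : ℕ → ℝ := fun m => 1 / ((m : ℝ) + 1) with hδ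
  have hδ0 : ∀ m, 0 < δ m := fun m => by positivity
  have hlim : ∀ t, Filter.Tendsto (fun m => Φ (δ m) t) Filter.atTop (nhds (Φ 0 t)) := fun t =>
    ((hcont.comp (Continuous.prodMk_left t)).tendsto 0).comp tendsto_one_div_add_atTop_nhds_zero_nat
  have hbound : ∀ m, ∫⁻ t, Φ (δ m) t ≤ ENNReal.ofReal Real.pi := by
    intro m
    have h := lintegral_poisson_inv_le hT (W := fun k => W k + δ m)
      (fun k => by have := hW k; have := hδ0 m; positivity) hε j (Y := 1 / δ m)
      (by have := hδ0 m; positivity)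
    have hδm := hδ0 m
    refine le_trans (le_of_eq (lintegral_congr fun t => ?_)) (h.trans (ENNReal.ofReal_le_ofReal ?_))
    · simp only [hΦ]
      congr 2
      field_simp
    · exact div_le_self Real.pi_pos.le (by linarith)
  calc _ = ∫⁻ t, Φ 0 t := by simp [hΦ]
    _ = ∫⁻ t, Filter.liminf (fun m => Φ (δ m) t) Filter.atTop :=
        lintegral_congr fun t => (hlim t).liminf_eq.symm
    _ ≤ Filter.liminf (fun m => ∫⁻ t, Φ (δ m) t) Filter.atTop :=
        lintegral_liminf_le fun m => (hcont.comp (Continuous.prodMk_right (δ m))).measurable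
    _ ≤ ENNReal.ofReal Real.pi := by
        refine Filter.liminf_le_of_le (by isBoundedDefault) fun b hb => ?_
        obtain ⟨m, hm⟩ := hb.exists
        exact hm.trans (hbound m)

lemma Matrix.IsHermitian.eq_sum_eigenvalues {M : Matrix n n ℂ} (hM : M.IsHermitian) :
    M = (hM.eigenvectorUnitary : Matrix n n ℂ) *
      diagonal (fun i => (hM.eigenvalues i : ℂ)) *
      star (hM.eigenvectorUnitary : Matrix n n ℂ) := by
  conv_lhs => rw [hM.spectral_theorem, Unitary.conjStarAlgAut_apply]
  rfl

lemma unitary_conj_diagonal_apply_self (U : Matrix n n ℂ) (c : n → ℂ) (j : n) :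
    (U * diagonal c * star U) j j = ∑ i, c i * ((‖U j i‖ ^ 2 : ℝ) : ℂ) := by
  rw [mul_apply]
  refine Finset.sum_congr rfl fun i _ => ?_
  rw [mul_diagonal, star_apply]
  have := Complex.mul_conj' (U j i)
  push_cast
  rw [← this]
  simp only [Complex.star_def]
  ring

lemma Matrix.IsHermitian.inv_sub_apply_self_im {M : Matrix n n ℂ} (hM : M.IsHermitian) (E : ℝ)
    {ε : ℝ} (hε : 0 < ε) (j : n) :
    ((M - diagonal (fun _ => (E : ℂ)) -
        diagonal fun _ => Complex.I * (ε : ℂ) : Matrix n n ℂ)⁻¹ j j).im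
      = ∑ i, ε / ((hM.eigenvalues i - E) ^ 2 + ε ^ 2) *
          ‖(hM.eigenvectorUnitary : Matrix n n ℂ) j i‖ ^ 2 := by
  set U := (hM.eigenvectorUnitary : Matrix n n ℂ) with hU
  have hUU : star U * U = 1 := Unitary.coe_star_mul_self _
  have hUU' : U * star U = 1 := Unitary.coe_mul_star_self _
  have hne : ∀ i, (hM.eigenvalues i : ℂ) - E - Complex.I * ε ≠ 0 := by
    intro i h
    have := congrArg Complex.im h
    simp at this
    exact hε.ne' this
  have hinv : (M - diagonal (fun _ => (E : ℂ)) -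
      diagonal fun _ => Complex.I * (ε : ℂ) : Matrix n n ℂ)⁻¹
      = U * diagonal (fun i => ((hM.eigenvalues i : ℂ) - E - Complex.I * ε)⁻¹) * star U := by
    refine inv_eq_right_inv ?_
    have h1 : (M - diagonal (fun _ => (E : ℂ)) -
        diagonal fun _ => Complex.I * (ε : ℂ) : Matrix n n ℂ)
        = U * diagonal (fun i => (hM.eigenvalues i : ℂ) - E - Complex.I * ε) * star U := by
      have h2 : (diagonal fun i => (hM.eigenvalues i : ℂ) - E - Complex.I * ε : Matrix n n ℂ)
          = diagonal (fun i => (hM.eigenvalues i : ℂ)) - ((E : ℂ) + Complex.I * ε) • 1 := by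
        rw [← diagonal_one, ← diagonal_smul, diagonal_sub]
        congr 1
        funext i
        simp
        ring
      rw [h2, mul_sub, sub_mul, ← hM.eq_sum_eigenvalues, Matrix.mul_smul, mul_one, Matrix.smul_mul,
        hUU', ← diagonal_one, ← diagonal_smul, sub_sub, diagonal_add]
      congr 2
      funext i
      simp
    rw [h1]
    calc _ = U * diagonal (fun i => (hM.eigenvalues i : ℂ) - E - Complex.I * ε) * (star U * U) *
          diagonal (fun i => ((hM.eigenvalues i : ℂ) - E - Complex.I * ε)⁻¹) * star U := by
          simp only [mul_assoc]
      _ = U * (diagonal (fun i => (hM.eigenvalues i : ℂ) - E - Complex.I * ε) *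
          diagonal (fun i => ((hM.eigenvalues i : ℂ) - E - Complex.I * ε)⁻¹)) * star U := by
          rw [hUU]; simp only [mul_assoc, mul_one]
      _ = 1 := by
          rw [diagonal_mul_diagonal]
          simp only [mul_inv_cancel₀ (hne _)]
          rw [diagonal_one, mul_one, hUU']
  rw [hinv, unitary_conj_diagonal_apply_self, Complex.im_sum]
  refine Finset.sum_congr rfl fun i _ => ?_
  rw [Complex.im_mul_ofReal]
  congr 1
  rw [Complex.inv_im]
  simp [Complex.normSq_apply]
  ring

lemma specProj_apply_self_re {M : Matrix n n ℂ} (hM : M.IsHermitian) (I : Set ℝ) (j : n) :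
    (specProj hM I j j).re = ∑ i, Set.indicator I (fun _ => (1 : ℝ)) (hM.eigenvalues i) *
      ‖(hM.eigenvectorUnitary : Matrix n n ℂ) j i‖ ^ 2 := by
  rw [specProj, unitary_conj_diagonal_apply_self, Complex.re_sum]
  refine Finset.sum_congr rfl fun i _ => ?_
  rw [Complex.re_mul_ofReal]
  by_cases h : hM.eigenvalues i ∈ I <;> simp [h]

lemma specProj_apply_self_re_nonneg {M : Matrix n n ℂ} (hM : M.IsHermitian) (I : Set ℝ) (j : n) :
    0 ≤ (specProj hM I j j).re := by
  rw [specProj_apply_self_re]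
  exact Finset.sum_nonneg fun i _ =>
    mul_nonneg (Set.indicator_nonneg (fun _ _ => zero_le_one) _) (sq_nonneg _)

lemma hasDerivAt_arctan_div (c : ℝ) {ε : ℝ} (hε : 0 < ε) (E : ℝ) :
    HasDerivAt (fun E => Real.arctan ((E - c) / ε)) (ε / ((c - E) ^ 2 + ε ^ 2)) E := by
  have h := (((hasDerivAt_id' E).sub_const c).div_const ε).arctan
  refine h.congr_deriv ?_
  field_simp
  ring

lemma continuous_lorentzian (c : ℝ) {ε : ℝ} (hε : 0 < ε) :
    Continuous fun E : ℝ => ε / ((c - E) ^ 2 + ε ^ 2) :=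
  continuous_const.div (by fun_prop) fun E => by positivity

/-- The spectral projection is dominated by the integrated imaginary part of the resolvent. -/
lemma two_arctan_mul_specProj_le {M : Matrix n n ℂ} (hM : M.IsHermitian) {E₁ E₂ : ℝ}
    (hE : E₁ ≤ E₂) (j : n) {δ : ℝ} (hδ : 0 < δ) :
    ENNReal.ofReal (2 * Real.arctan (1 / δ) * (specProj hM (Set.Icc E₁ E₂) j j).re) ≤
      ∫⁻ E in Set.Icc (E₁ - δ) (E₂ + δ), ENNReal.ofReal
        ((M - diagonal (fun _ => (E : ℂ)) -
          diagonal fun _ => Complex.I * ((δ ^ 2 : ℝ) : ℂ) : Matrix n n ℂ)⁻¹ j j).im := by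
  have hε : 0 < δ ^ 2 := by positivity
  simp only [hM.inv_sub_apply_self_im _ hε]
  have hcont : ∀ i, Continuous fun E : ℝ => δ ^ 2 / ((hM.eigenvalues i - E) ^ 2 + (δ ^ 2) ^ 2) *
      ‖(hM.eigenvectorUnitary : Matrix n n ℂ) j i‖ ^ 2 := fun i =>
    (continuous_lorentzian _ hε).mul continuous_const
  rw [← ofReal_integral_eq_lintegral_ofReal
    (continuous_finsetSum _ fun i _ => hcont i).integrableOn_Icc
    (Filter.Eventually.of_forall fun E => Finset.sum_nonneg fun i _ => by positivity)]
  refine ENNReal.ofReal_le_ofReal ?_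
  rw [integral_finsetSum _ fun i _ => (hcont i).integrableOn_Icc, specProj_apply_self_re,
    Finset.mul_sum]
  refine Finset.sum_le_sum fun i _ => ?_
  rw [integral_mul_const, ← mul_assoc]
  refine mul_le_mul_of_nonneg_right ?_ (sq_nonneg _)
  set c := hM.eigenvalues i
  by_cases hc : c ∈ Set.Icc E₁ E₂
  · rw [Set.indicator_of_mem hc, mul_one, integral_Icc_eq_integral_Ioc,
      ← intervalIntegral.integral_of_le (by linarith),
      intervalIntegral.integral_eq_sub_of_hasDerivAt (fun E _ => hasDerivAt_arctan_div c hε E)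
        ((continuous_lorentzian c hε).intervalIntegrable _ _)]
    have hδ' : 1 / δ = δ / δ ^ 2 := by field_simp
    have h1 : Real.arctan (1 / δ) ≤ Real.arctan ((E₂ + δ - c) / δ ^ 2) := by
      rw [hδ']
      refine Real.arctan_strictMono.monotone ?_
      gcongr
      linarith [hc.2]
    have h2 : Real.arctan ((E₁ - δ - c) / δ ^ 2) ≤ -Real.arctan (1 / δ) := by
      rw [hδ', ← Real.arctan_neg, ← neg_div]
      refine Real.arctan_strictMono.monotone ?_
      gcongr
      linarith [hc.1]
    linarith
  · rw [Set.indicator_of_notMem hc, mul_zero]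
    exact integral_nonneg fun E => by positivity

end Dissipative

section Translation

lemma lintegral_enorm_sub_comp_add_le_of_nonneg {f : ℝ → ℝ} (hfm : Measurable f)
    (hf : eVariationOn f Set.univ ≠ ⊤) {c : ℝ} (hc : 0 ≤ c) :
    ∫⁻ x, ‖f (x + c) - f x‖ₑ ≤ ENNReal.ofReal (c * (eVariationOn f Set.univ).toReal) := by
  set V : ℝ → ℝ := fun x => (eVariationOn f (Set.Iic x)).toReal with hV
  have hfin : ∀ x, eVariationOn f (Set.Iic x) ≠ ⊤ := fun x =>
    ne_top_of_le_ne_top hf (eVariationOn.mono f (Set.subset_univ _))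
  have hVmono : Monotone V := fun x y hxy =>
    ENNReal.toReal_mono (hfin y) (eVariationOn.mono f (Set.Iic_subset_Iic.2 hxy))
  have hVle : ∀ x, V x ≤ (eVariationOn f Set.univ).toReal := fun x =>
    ENNReal.toReal_mono hf (eVariationOn.mono f (Set.subset_univ _))
  have hV0 : ∀ x, 0 ≤ V x := fun x => ENNReal.toReal_nonneg
  have hVint : ∀ a b, IntervalIntegrable V volume a b := fun a b => hVmono.intervalIntegrable
  have hpt : ∀ x, ‖f (x + c) - f x‖ₑ ≤ ENNReal.ofReal (V (x + c) - V x) := by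
    intro x
    have h1 : eVariationOn f (Set.Iic x) + ‖f (x + c) - f x‖ₑ ≤ eVariationOn f (Set.Iic (x + c)) :=
      calc _ ≤ eVariationOn f (Set.Iic x) + eVariationOn f (Set.Icc x (x + c)) := by
            gcongr
            rw [← edist_eq_enorm_sub]
            exact eVariationOn.edist_le f ⟨by linarith, le_rfl⟩ ⟨le_rfl, by linarith⟩
        _ ≤ eVariationOn f (Set.Iic x ∪ Set.Icc x (x + c)) :=
            eVariationOn.add_le_union f fun a ha b hb => le_trans ha hb.1
        _ ≤ _ := eVariationOn.mono f (Set.union_subset (Set.Iic_subset_Iic.2 (by linarith))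
            fun y hy => hy.2)
    rw [hV, ENNReal.ofReal_sub _ ENNReal.toReal_nonneg, ENNReal.ofReal_toReal (hfin _),
      ENNReal.ofReal_toReal (hfin _)]
    exact ENNReal.le_sub_of_add_le_left (hfin x) h1
  have hbound : ∀ N : ℕ, ∫⁻ x in Set.Ioc (-(N : ℝ)) N, ‖f (x + c) - f x‖ₑ ≤
      ENNReal.ofReal (c * (eVariationOn f Set.univ).toReal) := by
    intro N
    have hN : -(N : ℝ) ≤ N := by linarith [Nat.cast_nonneg (α := ℝ) N]
    have hintegral : IntervalIntegrable (fun x => V (x + c)) volume (-(N : ℝ)) N :=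
      (hVmono.comp (fun x y h => by simpa using h : Monotone fun x : ℝ => x + c)).intervalIntegrable
    refine (lintegral_mono hpt).trans ?_
    rw [← ofReal_integral_eq_lintegral_ofReal
      (((intervalIntegrable_iff_integrableOn_Ioc_of_le hN).1 (hintegral.sub (hVint _ _))))
      (Filter.Eventually.of_forall fun x => sub_nonneg.2 (hVmono (by linarith)))]
    refine ENNReal.ofReal_le_ofReal ?_
    rw [← intervalIntegral.integral_of_le hN, intervalIntegral.integral_sub hintegral (hVint _ _),
      intervalIntegral.integral_comp_add_right V]
    have h1 := intervalIntegral.integral_interval_sub_interval_comm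
      (hVint (-(N : ℝ) + c) (N + c)) (hVint (-(N : ℝ)) N) (hVint (-(N : ℝ) + c) (-(N : ℝ)))
    have h2 : 0 ≤ ∫ x in (-(N : ℝ))..(-(N : ℝ) + c), V x :=
      intervalIntegral.integral_nonneg (by linarith) fun x _ => hV0 x
    have h3 : ∫ x in (N : ℝ)..(N + c), V x ≤ c * (eVariationOn f Set.univ).toReal := by
      have := intervalIntegral.integral_mono_on (by linarith : (N : ℝ) ≤ N + c) (hVint _ _)
        (intervalIntegrable_const (μ := volume)) fun x _ => hVle x
      simpa using this
    have h5 := intervalIntegral.integral_symm (f := V) (μ := volume) (-(N : ℝ)) (-(N : ℝ) + c)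
    have h4 := intervalIntegral.integral_symm (f := V) (μ := volume) (N : ℝ) (N + c)
    linarith
  have hcover : AECover volume Filter.atTop fun N : ℕ => Set.Ioc (-(N : ℝ)) N :=
    aecover_Ioc (Filter.tendsto_neg_atTop_atBot.comp tendsto_natCast_atTop_atTop)
      tendsto_natCast_atTop_atTop
  exact le_of_tendsto' (hcover.lintegral_tendsto_of_countably_generated
    (by fun_prop)) hbound

/-- The `L¹` modulus of continuity of a function of bounded variation is at most linear. -/
lemma lintegral_enorm_sub_comp_add_le {f : ℝ → ℝ} (hfm : Measurable f)
    (hf : eVariationOn f Set.univ ≠ ⊤) (c : ℝ) :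
    ∫⁻ x, ‖f (x + c) - f x‖ₑ ≤ ENNReal.ofReal (|c| * (eVariationOn f Set.univ).toReal) := by
  rcases le_total 0 c with hc | hc
  · rw [abs_of_nonneg hc]
    exact lintegral_enorm_sub_comp_add_le_of_nonneg hfm hf hc
  · rw [abs_of_nonpos hc]
    refine le_trans (le_of_eq ?_)
      (lintegral_enorm_sub_comp_add_le_of_nonneg hfm hf (neg_nonneg.2 hc))
    rw [← lintegral_add_right_eq_self (fun x => ‖f (x + -c) - f x‖ₑ) c]
    refine lintegral_congr fun x => ?_
    rw [add_neg_cancel_right, ← edist_eq_enorm_sub, edist_comm, edist_eq_enorm_sub]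

variable {ι : Type*} [Fintype ι]

lemma lintegral_prod_ofReal {g : ι → ℝ → ℝ} (hg0 : ∀ i x, 0 ≤ g i x)
    (hg : ∀ i, Integrable (g i)) :
    ∫⁻ x : ι → ℝ, ∏ i, ENNReal.ofReal (g i (x i)) = ∏ i, ∫⁻ x, ENNReal.ofReal (g i x) := by
  have h1 := integral_fintype_prod_volume_eq_prod g
  have h2 : ∀ x : ι → ℝ, ∏ i, ENNReal.ofReal (g i (x i)) = ENNReal.ofReal (∏ i, g i (x i)) :=
    fun x => (ENNReal.ofReal_prod_of_nonneg fun i _ => hg0 i _).symm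
  have h3 : Integrable fun x : ι → ℝ => ∏ i, g i (x i) := Integrable.fintype_prod hg
  simp only [h2]
  rw [← ofReal_integral_eq_lintegral_ofReal h3
    (Filter.Eventually.of_forall fun x => Finset.prod_nonneg fun i _ => hg0 i _), h1,
    ENNReal.ofReal_prod_of_nonneg fun i _ => integral_nonneg (hg0 i)]
  exact Finset.prod_congr rfl fun i _ =>
    ofReal_integral_eq_lintegral_ofReal (hg i) (Filter.Eventually.of_forall (hg0 i))

lemma pi_withDensity_ofReal {f : ℝ → ℝ} (hf0 : ∀ x, 0 ≤ f x) (hf : Integrable f) :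
    Measure.pi (fun _ : ι => volume.withDensity fun x => ENNReal.ofReal (f x)) =
      volume.withDensity fun ω : ι → ℝ => ∏ i, ENNReal.ofReal (f (ω i)) := by
  refine Measure.pi_eq fun s hs => ?_
  rw [withDensity_apply _ (MeasurableSet.univ_pi hs),
    ← lintegral_indicator (MeasurableSet.univ_pi hs)]
  have h := lintegral_prod_ofReal (g := fun i => (s i).indicator f)
    (fun i x => Set.indicator_nonneg (fun x _ => hf0 x) x) fun i => hf.indicator (hs i)
  have h2 : ∀ i, ∫⁻ x, ENNReal.ofReal ((s i).indicator f x) =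
      volume.withDensity (fun x => ENNReal.ofReal (f x)) (s i) := by
    intro i
    rw [withDensity_apply _ (hs i), ← lintegral_indicator (hs i)]
    refine lintegral_congr fun x => ?_
    by_cases hx : x ∈ s i <;> simp [hx]
  simp only [h2] at h
  rw [← h]
  refine lintegral_congr fun x => ?_
  by_cases hx : x ∈ Set.univ.pi s
  · rw [Set.indicator_of_mem hx]
    exact Finset.prod_congr rfl fun i _ => by rw [Set.indicator_of_mem (hx i (Set.mem_univ i))]
  · rw [Set.indicator_of_notMem hx]
    simp only [Set.mem_univ_pi, not_forall] at hx
    obtain ⟨i, hi⟩ := hx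
    exact (Finset.prod_eq_zero (Finset.mem_univ i) (by simp [hi])).symm

lemma lintegral_enorm_prod_sub_prod_le [DecidableEq ι] {f g : ι → ℝ → ℝ} (hf0 : ∀ i x, 0 ≤ f i x)
    (hg0 : ∀ i x, 0 ≤ g i x) (hf : ∀ i, Integrable (f i)) (hg : ∀ i, Integrable (g i))
    (hf1 : ∀ i, ∫⁻ x, ENNReal.ofReal (f i x) = 1) (hg1 : ∀ i, ∫⁻ x, ENNReal.ofReal (g i x) = 1) :
    ∫⁻ x : ι → ℝ, ‖∏ i, g i (x i) - ∏ i, f i (x i)‖ₑ ≤ ∑ i, ∫⁻ x, ‖g i x - f i x‖ₑ := by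
  set h : Finset ι → ι → ℝ → ℝ := fun S i => if i ∈ S then g i else f i with hh
  have hintegral : ∀ S i, Integrable (h S i) := fun S i => by
    by_cases hi : i ∈ S <;> simp [hh, hi, hf, hg]
  have h0 : ∀ S i x, 0 ≤ h S i x := fun S i x => by
    by_cases hi : i ∈ S <;> simp [hh, hi, hf0, hg0]
  have h1 : ∀ S i, ∫⁻ x, ENNReal.ofReal (h S i x) = 1 := fun S i => by
    by_cases hi : i ∈ S <;> simp [hh, hi, hf1, hg1]
  have hprodint : ∀ S, Integrable fun x : ι → ℝ => ∏ i, h S i (x i) := fun S =>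
    Integrable.fintype_prod (hintegral S)
  have key : ∀ S : Finset ι, ∫⁻ x : ι → ℝ, ‖∏ i, h S i (x i) - ∏ i, f i (x i)‖ₑ ≤
      ∑ i ∈ S, ∫⁻ x, ‖g i x - f i x‖ₑ := by
    intro S
    induction S using Finset.induction_on with
    | empty => simp [hh]
    | insert a S ha ih =>
      have hdiff : ∀ x : ι → ℝ, ‖∏ i, h (insert a S) i (x i) - ∏ i, h S i (x i)‖ₑ =
          ∏ i, ENNReal.ofReal (Function.update (h S) a (fun y => |g a y - f a y|) i (x i)) := by
        intro x
        rw [← Finset.mul_prod_erase _ _ (Finset.mem_univ a),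
          ← Finset.mul_prod_erase _ (fun i => h S i (x i)) (Finset.mem_univ a),
          ← Finset.mul_prod_erase _ (fun i => ENNReal.ofReal _) (Finset.mem_univ a)]
        have e1 : ∏ i ∈ Finset.univ.erase a, h (insert a S) i (x i) =
            ∏ i ∈ Finset.univ.erase a, h S i (x i) := by
          refine Finset.prod_congr rfl fun i hi => ?_
          simp [hh, Finset.ne_of_mem_erase hi]
        have e2 : ∏ i ∈ Finset.univ.erase a,
            ENNReal.ofReal (Function.update (h S) a (fun y => |g a y - f a y|) i (x i)) =
            ENNReal.ofReal (∏ i ∈ Finset.univ.erase a, h S i (x i)) := by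
          rw [ENNReal.ofReal_prod_of_nonneg fun i _ => h0 S i _]
          refine Finset.prod_congr rfl fun i hi => ?_
          rw [Function.update_of_ne (Finset.ne_of_mem_erase hi)]
        rw [e1, e2, ← sub_mul, enorm_mul, Function.update_self,
          Real.enorm_of_nonneg (Finset.prod_nonneg fun i _ => h0 S i _), Real.enorm_eq_ofReal_abs]
        simp [hh, ha]
      have hstep : ∫⁻ x : ι → ℝ, ‖∏ i, h (insert a S) i (x i) - ∏ i, h S i (x i)‖ₑ =
          ∫⁻ x, ‖g a x - f a x‖ₑ := by
        simp only [hdiff]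
        rw [lintegral_prod_ofReal, ← Finset.mul_prod_erase _ _ (Finset.mem_univ a)]
        · rw [Function.update_self, Finset.prod_eq_one, mul_one]
          · simp only [Real.enorm_eq_ofReal_abs]
          · intro i hi
            rw [Function.update_of_ne (Finset.ne_of_mem_erase hi)]
            exact h1 S i
        · intro i x
          rcases eq_or_ne i a with rfl | hi
          · simp
          · rw [Function.update_of_ne hi]; exact h0 S i x
        · intro i
          rcases eq_or_ne i a with rfl | hi
          · rw [Function.update_self]; exact ((hg i).sub (hf i)).abs
          · rw [Function.update_of_ne hi]; exact hintegral S i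
      calc _ ≤ ∫⁻ x : ι → ℝ, (‖∏ i, h (insert a S) i (x i) - ∏ i, h S i (x i)‖ₑ +
              ‖∏ i, h S i (x i) - ∏ i, f i (x i)‖ₑ) := by
            refine lintegral_mono fun x => ?_
            rw [← sub_add_sub_cancel _ (∏ i, h S i (x i))]
            exact enorm_add_le _ _
        _ = (∫⁻ x : ι → ℝ, ‖∏ i, h (insert a S) i (x i) - ∏ i, h S i (x i)‖ₑ) +
              ∫⁻ x : ι → ℝ, ‖∏ i, h S i (x i) - ∏ i, f i (x i)‖ₑ := lintegral_add_left'
            ((hprodint _).sub (hprodint _)).aestronglyMeasurable.enorm _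
        _ ≤ _ := by
            rw [hstep, Finset.sum_insert ha]
            gcongr
  simpa [hh] using key Finset.univ

/-- Averaging along the direction `b`: if the integrals of `F` along all lines parallel to `b` are
at most `K`, then the integral of `F` against a probability density `ρ` is bounded by `K` times the
`L¹` modulus of continuity of `ρ` along `b`. -/
lemma lintegral_mul_le_of_lintegral_line_le {F : (ι → ℝ) → ENNReal} (hF : Measurable F)
    {M K C : ENNReal} (hM : M ≠ ⊤) (hK : K ≠ ⊤) (hC : C ≠ ⊤) (hFM : ∀ ω, F ω ≤ M) (b : ι → ℝ)
    (hFK : ∀ ω, ∫⁻ s : ℝ, F (ω - s • b) ≤ K) {ρ : (ι → ℝ) → ℝ} (hρ : Measurable ρ)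
    (hρ1 : ∫⁻ ω, ENNReal.ofReal (ρ ω) = 1)
    (hρC : ∀ h : ℝ, 0 ≤ h → ∫⁻ ω, ‖ρ (ω + h • b) - ρ ω‖ₑ ≤ ENNReal.ofReal h * C) :
    ∫⁻ ω, F ω * ENNReal.ofReal (ρ ω) ≤ K * C := by
  set G : ℝ → ENNReal := fun s => ∫⁻ ω, F (ω - s • b) * ENNReal.ofReal (ρ ω) with hG
  have hFb : ∀ s : ℝ, Measurable fun ω => F (ω - s • b) := fun s =>
    hF.comp (by fun_prop)
  have hFu : Measurable fun p : ℝ × (ι → ℝ) => F (p.2 - p.1 • b) := hF.comp (by fun_prop)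
  have hρm : Measurable fun ω => ENNReal.ofReal (ρ ω) := hρ.ennreal_ofReal
  have hem : ∀ h : ℝ, Measurable fun ω => ‖ρ (ω + h • b) - ρ ω‖ₑ := fun h =>
    ((hρ.comp (by fun_prop : Measurable fun ω : ι → ℝ => ω + h • b)).sub hρ).enorm
  have hstep : ∀ s h : ℝ,
      G s ≤ G (s + h) + ∫⁻ ω, F (ω - s • b) * ‖ρ (ω + h • b) - ρ ω‖ₑ := by
    intro s h
    have h1 : G (s + h) = ∫⁻ ω, F (ω - s • b) * ENNReal.ofReal (ρ (ω + h • b)) := by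
      refine (lintegral_add_right_eq_self
        (fun ω => F (ω - (s + h) • b) * ENNReal.ofReal (ρ ω)) (h • b)).symm.trans ?_
      refine lintegral_congr fun ω => ?_
      rw [show ω + h • b - (s + h) • b = ω - s • b by module]
    rw [h1]
    refine le_of_le_of_eq (lintegral_mono fun ω => ?_)
      (lintegral_add_right _ ((hFb s).mul (hem h)))
    beta_reduce
    rw [← mul_add]
    gcongr
    rw [Real.enorm_eq_ofReal_abs]
    refine le_trans (ENNReal.ofReal_le_ofReal ?_) ENNReal.ofReal_add_le
    linarith [neg_abs_le (ρ (ω + h • b) - ρ ω)]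
  have hline : ∀ (w : (ι → ℝ) → ENNReal), Measurable w → ∀ S : Set ℝ,
      ∫⁻ s in S, ∫⁻ ω, F (ω - s • b) * w ω ≤ K * ∫⁻ ω, w ω := by
    intro w hw S
    refine (setLIntegral_le_lintegral _ _).trans ?_
    rw [lintegral_lintegral_swap (hFu.mul (hw.comp measurable_snd)).aemeasurable,
      ← lintegral_const_mul _ hw]
    refine lintegral_mono fun ω => ?_
    have hs : Measurable fun s : ℝ => F (ω - s • b) := hF.comp (by fun_prop)
    rw [lintegral_mul_const _ hs]
    gcongr
    exact hFK ω
  have hGm : Measurable G := (hFu.mul (hρm.comp measurable_snd)).lintegral_prod_right'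
  have hshort : ∀ h : ℝ, 0 < h → ∫⁻ s in Set.Ioc 0 h, G s ≤ K * (ENNReal.ofReal h * C) := by
    intro h hh
    have hfin : ∫⁻ s in Set.Ioi h, G s ≠ ⊤ :=
      ne_top_of_le_ne_top hK (by simpa [hρ1] using hline _ hρm (Set.Ioi h))
    have hshift : ∫⁻ s in Set.Ioi 0, G (s + h) = ∫⁻ s in Set.Ioi h, G s := by
      rw [← lintegral_indicator measurableSet_Ioi, ← lintegral_indicator measurableSet_Ioi,
        ← lintegral_add_right_eq_self ((Set.Ioi h).indicator G) h]
      refine lintegral_congr fun s => ?_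
      simp [Set.indicator]
    have htotal : ∫⁻ s in Set.Ioi 0, G s ≤
        (∫⁻ s in Set.Ioi h, G s) + K * (ENNReal.ofReal h * C) :=
      calc _ ≤ ∫⁻ s in Set.Ioi 0, (G (s + h) +
              ∫⁻ ω, F (ω - s • b) * ‖ρ (ω + h • b) - ρ ω‖ₑ) :=
            lintegral_mono fun s => hstep s h
        _ = (∫⁻ s in Set.Ioi 0, G (s + h)) +
              ∫⁻ s in Set.Ioi 0, ∫⁻ ω, F (ω - s • b) * ‖ρ (ω + h • b) - ρ ω‖ₑ :=
            lintegral_add_left (hGm.comp (by fun_prop)) _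
        _ ≤ _ := by
            rw [hshift]
            gcongr
            refine (hline _ (hem h) _).trans ?_
            gcongr
            exact hρC h hh.le
    rw [← Set.Ioc_union_Ioi_eq_Ioi hh.le, lintegral_union measurableSet_Ioi
      (Set.Ioc_disjoint_Ioi le_rfl), add_comm] at htotal
    exact (ENNReal.add_le_add_iff_left hfin).1 htotal
  have hbound : ∀ h : ℝ, 0 < h → G 0 ≤ K * C + M * C * ENNReal.ofReal h := by
    intro h hh
    have hpt : ∀ s ∈ Set.Ioc 0 h, G 0 ≤ G s + M * C * ENNReal.ofReal h := by
      intro s hs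
      refine (hstep 0 s).trans ?_
      rw [zero_add]
      gcongr
      calc _ ≤ ∫⁻ ω, M * ‖ρ (ω + s • b) - ρ ω‖ₑ := by
            gcongr
            exact hFM _
        _ = M * ∫⁻ ω, ‖ρ (ω + s • b) - ρ ω‖ₑ := lintegral_const_mul _ (hem s)
        _ ≤ M * (ENNReal.ofReal s * C) := by gcongr; exact hρC s hs.1.le
        _ ≤ M * (ENNReal.ofReal h * C) := by gcongr; exact hs.2
        _ = _ := by ring
    have hvol : volume (Set.Ioc 0 h) = ENNReal.ofReal h := by rw [Real.volume_Ioc, sub_zero]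
    have hintegral : G 0 * ENNReal.ofReal h ≤
        (K * C + M * C * ENNReal.ofReal h) * ENNReal.ofReal h :=
      calc _ = ∫⁻ _ in Set.Ioc 0 h, G 0 := by rw [setLIntegral_const, hvol]
        _ ≤ ∫⁻ s in Set.Ioc 0 h, (G s + M * C * ENNReal.ofReal h) :=
            setLIntegral_mono' measurableSet_Ioc hpt
        _ = (∫⁻ s in Set.Ioc 0 h, G s) + M * C * ENNReal.ofReal h * ENNReal.ofReal h := by
            rw [lintegral_add_right _ measurable_const, setLIntegral_const, hvol]
        _ ≤ K * (ENNReal.ofReal h * C) + M * C * ENNReal.ofReal h * ENNReal.ofReal h := by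
            gcongr
            exact hshort h hh
        _ = _ := by ring
    exact (ENNReal.mul_le_mul_iff_left (ENNReal.ofReal_pos.2 hh).ne' ENNReal.ofReal_ne_top).1 hintegral
  have hlim : Filter.Tendsto (fun h : ℝ => K * C + M * C * ENNReal.ofReal h)
      (nhdsWithin 0 (Set.Ioi 0)) (nhds (K * C)) := by
    have h1 : Filter.Tendsto ENNReal.ofReal (nhdsWithin 0 (Set.Ioi 0)) (nhds 0) := by
      simpa using (ENNReal.continuous_ofReal.tendsto 0).mono_left nhdsWithin_le_nhds
    simpa using (ENNReal.Tendsto.const_mul h1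
      (Or.inr (ENNReal.mul_ne_top hM hC))).const_add (K * C)
  have hG0 : G 0 = ∫⁻ ω, F ω * ENNReal.ofReal (ρ ω) := by simp [hG]
  rw [← hG0]
  exact ge_of_tendsto hlim (eventually_nhdsWithin_of_forall fun h hh => hbound h hh)

/-- The version of `lintegral_mul_le_of_lintegral_line_le` for independent random variables with a
common density of bounded variation. -/
lemma lintegral_pi_withDensity_le_of_lintegral_line_le {F : (ι → ℝ) → ENNReal} (hF : Measurable F)
    {M K : ENNReal} (hM : M ≠ ⊤) (hK : K ≠ ⊤) (hFM : ∀ ω, F ω ≤ M) (b : ι → ℝ)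
    (hFK : ∀ ω, ∫⁻ s : ℝ, F (ω - s • b) ≤ K) {f : ℝ → ℝ} (hf0 : ∀ x, 0 ≤ f x) (hfm : Measurable f)
    (hf1 : ∫ x, f x = 1) (hfBV : eVariationOn f Set.univ ≠ ⊤) :
    ∫⁻ ω, F ω ∂(Measure.pi fun _ : ι => volume.withDensity fun x => ENNReal.ofReal (f x)) ≤
      K * ENNReal.ofReal ((eVariationOn f Set.univ).toReal * ∑ i, |b i|) := by
  classical
  have hfi : Integrable f := .of_integral_ne_zero (by simp [hf1])
  have hfl : ∫⁻ x, ENNReal.ofReal (f x) = 1 := by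
    rw [← ofReal_integral_eq_lintegral_ofReal hfi (Filter.Eventually.of_forall hf0), hf1,
      ENNReal.ofReal_one]
  have hprod : ∀ ω : ι → ℝ, ∏ i, ENNReal.ofReal (f (ω i)) = ENNReal.ofReal (∏ i, f (ω i)) :=
    fun ω => (ENNReal.ofReal_prod_of_nonneg fun i _ => hf0 _).symm
  have hρm : Measurable fun ω : ι → ℝ => ∏ i, f (ω i) :=
    Finset.measurable_prod _ fun i _ => hfm.comp (measurable_pi_apply i)
  rw [pi_withDensity_ofReal hf0 hfi]
  simp only [hprod]
  rw [lintegral_withDensity_eq_lintegral_mul _ hρm.ennreal_ofReal hF]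
  simp only [Pi.mul_apply, mul_comm _ (F _)]
  refine lintegral_mul_le_of_lintegral_line_le hF hM hK ENNReal.ofReal_ne_top hFM b hFK hρm ?_ ?_
  · simp only [← hprod]
    rw [lintegral_prod_ofReal (fun _ => hf0) fun _ => hfi]
    simp [hfl]
  · intro h hh
    have h1 : ∀ i, ∫⁻ x, ENNReal.ofReal (f (x + h * b i)) = 1 := fun i => by
      rw [lintegral_add_right_eq_self (fun x => ENNReal.ofReal (f x)), hfl]
    refine (lintegral_enorm_prod_sub_prod_le (f := fun _ => f) (g := fun i x => f (x + h * b i))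
      (fun _ => hf0) (fun i x => hf0 _) (fun _ => hfi) (fun i => hfi.comp_add_right _)
      (fun _ => hfl) h1).trans ?_
    refine (Finset.sum_le_sum fun i _ => lintegral_enorm_sub_comp_add_le hfm hfBV _).trans ?_
    rw [← ENNReal.ofReal_mul hh, ← ENNReal.ofReal_sum_of_nonneg fun i _ => by positivity]
    refine ENNReal.ofReal_le_ofReal (le_of_eq ?_)
    simp only [abs_mul, abs_of_nonneg hh, Finset.mul_sum]
    exact Finset.sum_congr rfl fun i _ => by ring

end Translation

section Convolution

/-- If the convolution `∑ α_k v(· - k)` is supported in the half space `-R ≤ σ` and `α` does not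
vanish on the half space `σ ≤ 0`, then `v` is supported in `-R ≤ σ`. -/
lemma neg_le_of_support_convolution {d : ℕ} {α v : (Fin d → ℤ) → ℝ}
    (hα : (Function.support α).Finite) (hv : (Function.support v).Finite)
    (σ : (Fin d → ℤ) →+ ℤ) {R : ℤ} (hσ : ∃ a, α a ≠ 0 ∧ σ a ≤ 0)
    (hR : ∀ x, ∑ᶠ k, α k * v (x - k) ≠ 0 → -R ≤ σ x) {x : Fin d → ℤ} (hx : v x ≠ 0) :
    -R ≤ σ x := by
  classical
  obtain ⟨a, ha, ha0⟩ := hσ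
  obtain ⟨a₁, ha₁, ha₁min⟩ := hα.toFinset.exists_min_image σ ⟨a, by simpa using ha⟩
  obtain ⟨c₁, hc₁, hc₁min⟩ := hv.toFinset.exists_min_image σ ⟨x, by simpa using hx⟩
  simp only [Set.Finite.mem_toFinset, Function.mem_support] at ha₁ ha₁min hc₁ hc₁min
  obtain ⟨p, hp, q, hq, hpq⟩ := UniqueSums.uniqueAdd_of_nonempty
    (A := hα.toFinset.filter fun y => σ y = σ a₁) (B := hv.toFinset.filter fun y => σ y = σ c₁)
    ⟨a₁, by simpa using ha₁⟩ ⟨c₁, by simpa using hc₁⟩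
  simp only [Finset.mem_filter, Set.Finite.mem_toFinset, Function.mem_support] at hp hq
  have hsum : ∑ᶠ k, α k * v (p + q - k) = α p * v q := by
    rw [finsum_eq_single _ p, add_sub_cancel_left]
    intro k hk
    by_contra hne
    have h1 := ha₁min k (left_ne_zero_of_mul hne)
    have h2 := hc₁min _ (right_ne_zero_of_mul hne)
    rw [map_sub, map_add, hp.2, hq.2] at h2
    refine hk (hpq (a := k) (b := p + q - k) ?_ ?_ (by abel)).1
    · simp only [Finset.mem_filter, Set.Finite.mem_toFinset, Function.mem_support]
      exact ⟨left_ne_zero_of_mul hne, by linarith⟩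
    · simp only [Finset.mem_filter, Set.Finite.mem_toFinset, Function.mem_support, map_sub,
        map_add, hp.2, hq.2]
      exact ⟨right_ne_zero_of_mul hne, by linarith⟩
  have h3 := hR (p + q) (by rw [hsum]; exact mul_ne_zero hp.1 hq.1)
  rw [map_add, hp.2, hq.2] at h3
  linarith [ha₁min a ha, hc₁min x hx]

lemma exists_ne_zero_coord_nonpos_of_mul_eq_one {d s : ℕ} {α : (Fin d → ℤ) → ℝ}
    {A B : Matrix (DCube d s) (DCube d s) ℝ} (hA : ∀ j k, A j k = α (j.emb - k.emb))
    (hAB : A * B = 1) (i : Fin d) :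
    (∃ a, α a ≠ 0 ∧ a i ≤ 0) ∧ ∃ a, α a ≠ 0 ∧ 0 ≤ a i := by
  have hrow : ∀ j : DCube d s, ∃ k : DCube d s, α (j.emb - k.emb) ≠ 0 := by
    intro j
    by_contra! h
    have h1 : (A * B) j j = 0 := by
      rw [mul_apply]
      exact Finset.sum_eq_zero fun k _ => by rw [hA, h, zero_mul]
    simp [hAB] at h1
  have hs : -(s : ℤ) ≤ s := by omega
  obtain ⟨k, hk⟩ := hrow fun _ => ⟨-(s : ℤ), le_rfl, hs⟩
  obtain ⟨k', hk'⟩ := hrow fun _ => ⟨s, hs, le_rfl⟩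
  have h1 := (k i).2.1
  have h2 := (k' i).2.2
  exact ⟨⟨_, hk, by simp only [DCube.emb, Pi.sub_apply]; omega⟩,
    ⟨_, hk', by simp only [DCube.emb, Pi.sub_apply]; omega⟩⟩

lemma finite_support_of_abs_le {d r : ℕ} {v : (Fin d → ℤ) → ℝ}
    (hv : ∀ x, v x ≠ 0 → ∀ i, |x i| ≤ (r : ℤ)) : (Function.support v).Finite :=
  (Set.Finite.pi' fun _ => Set.finite_Icc (-(r : ℤ)) r).subset
    fun x hx i => abs_le.1 (hv x hx i)

lemma DCube.emb_injective {d s : ℕ} : Function.Injective (DCube.emb (d := d) (s := s)) :=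
  fun _ _ h => funext fun i => Subtype.ext (congrFun h i)

lemma DCube.exists_emb_eq {d s : ℕ} {x : Fin d → ℤ} (hx : ∀ i, |x i| ≤ (s : ℤ)) :
    ∃ k : DCube d s, k.emb = x :=
  ⟨fun i => ⟨x i, abs_le.1 (hx i)⟩, rfl⟩

/-- The linear combination of the translates of the convolution of `α` and `v` with coefficients
in a column of the inverse of `A` is the corresponding translate of `v`. -/
lemma sum_inv_mul_convolution {d l r R : ℕ} {α v : (Fin d → ℤ) → ℝ}
    (hvr : ∀ x, v x ≠ 0 → ∀ i, |x i| ≤ (r : ℤ)) (hvR : ∀ x, v x ≠ 0 → ∀ i, |x i| ≤ (R : ℤ))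
    {A B : Matrix (DCube d (l + R)) (DCube d (l + R)) ℝ}
    (hA : ∀ j k : DCube d (l + R), (∀ i, |(j i : ℤ)| ≤ ((l : ℤ) + r)) →
      A j k = α (j.emb - k.emb))
    (hAB : A * B = 1) (x : DCube d l) (j : DCube d (l + R)) :
    ∑ k, B k j * ∑ᶠ m, α m * v (x.emb - k.emb - m) = v (x.emb - j.emb) := by
  classical
  have hx : ∀ i, |x.emb i| ≤ (l : ℤ) := fun i => abs_le.2 (x i).2
  have hconv : ∀ k : DCube d (l + R),
      ∑ᶠ m, α m * v (x.emb - k.emb - m) = ∑ p, A p k * v (x.emb - p.emb) := by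
    intro k
    have h1 : ∑ᶠ m, α m * v (x.emb - k.emb - m) =
        ∑ᶠ p, α (p - k.emb) * v (x.emb - p) := by
      rw [← finsum_comp_equiv (Equiv.subRight k.emb)]
      refine finsum_congr fun p => ?_
      simp only [Equiv.subRight_apply]
      rw [sub_sub, add_sub_cancel]
    rw [h1, finsum_eq_sum_of_support_subset
      (s := Finset.univ.map ⟨DCube.emb (d := d) (s := l + R), DCube.emb_injective⟩)]
    · rw [Finset.sum_map]
      refine Finset.sum_congr rfl fun p _ => ?_
      simp only [Function.Embedding.coeFn_mk]
      by_cases hp : v (x.emb - p.emb) = 0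
      · simp [hp]
      · rw [hA p k fun i => ?_]
        have h2 := hvr _ hp i
        have h3 := hx i
        rw [Pi.sub_apply, abs_le] at h2
        rw [abs_le] at h3 ⊢
        change _ ≤ p.emb i ∧ p.emb i ≤ _
        omega
    · intro p hp
      have hp' := right_ne_zero_of_mul hp
      have hpl : ∀ i, |p i| ≤ ((l + R : ℕ) : ℤ) := fun i => by
        have h2 := hvR _ hp' i
        have h3 := hx i
        rw [Pi.sub_apply, abs_le] at h2
        rw [abs_le] at h3 ⊢
        push_cast
        omega
      obtain ⟨q, rfl⟩ := DCube.exists_emb_eq hpl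
      simp
  simp only [hconv, Finset.mul_sum]
  rw [Finset.sum_comm]
  calc _ = ∑ p, (A * B) p j * v (x.emb - p.emb) := by
        refine Finset.sum_congr rfl fun p _ => ?_
        rw [mul_apply, Finset.sum_mul]
        exact Finset.sum_congr rfl fun k _ => by ring
    _ = _ := by simp [hAB, Matrix.one_apply]

lemma abs_le_of_support_convolution {d l r R : ℕ} {α v : (Fin d → ℤ) → ℝ}
    (hα : (Function.support α).Finite) (hvr : ∀ x, v x ≠ 0 → ∀ i, |x i| ≤ (r : ℤ))
    (hR : ∀ x, ∑ᶠ k, α k * v (x - k) ≠ 0 → ∀ i, |x i| ≤ (R : ℤ))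
    {A B : Matrix (DCube d (l + R)) (DCube d (l + R)) ℝ}
    (hA : ∀ j k : DCube d (l + R), (∀ i, |(j i : ℤ)| ≤ ((l : ℤ) + r)) →
      A j k = α (j.emb - k.emb))
    (hAB : A * B = 1) (x : Fin d → ℤ) (hx : v x ≠ 0) (i : Fin d) : |x i| ≤ (R : ℤ) := by
  rcases le_total r R with h | h
  · exact (hvr x hx i).trans (by exact_mod_cast h)
  · have hA' : ∀ j k, A j k = α (j.emb - k.emb) := fun j k => hA j k fun i => by
      refine (abs_le.2 (j i).2).trans ?_
      push_cast
      omega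
    obtain ⟨⟨a, ha, ha0⟩, ⟨b, hb, hb0⟩⟩ := exists_ne_zero_coord_nonpos_of_mul_eq_one hA' hAB i
    have hvfin := finite_support_of_abs_le hvr
    have h1 := neg_le_of_support_convolution hα hvfin (Pi.evalAddMonoidHom (fun _ => ℤ) i)
      ⟨a, ha, ha0⟩ (fun y hy => (abs_le.1 (hR y hy i)).1) hx
    have h2 := neg_le_of_support_convolution hα hvfin (-Pi.evalAddMonoidHom (fun _ => ℤ) i)
      ⟨b, hb, neg_nonpos.2 hb0⟩ (fun y hy => neg_le_neg (abs_le.1 (hR y hy i)).2) hx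
    exact abs_le.2 ⟨h1, neg_le_neg_iff.1 h2⟩

end Convolution

section Wegner

variable {n ι : Type*} [Fintype n] [DecidableEq n] [Fintype ι]

/-- A Wegner estimate for the diagonal elements of the spectral projections of a family of Hermitian
matrices, which along the direction `b` depends linearly and monotonically on its parameters. -/
lemma lintegral_specProj_apply_self_le {H : (ι → ℝ) → Matrix n n ℂ}
    (hH : ∀ ω, (H ω).IsHermitian) (hcont : Continuous H) {b : ι → ℝ} {W : n → ℝ}
    (hW : ∀ k, 0 ≤ W k) {j : n} (hj : 1 ≤ W j)
    (hline : ∀ ω s, H (ω - s • b) = H ω - diagonal fun k => ((s * W k : ℝ) : ℂ))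
    {f : ℝ → ℝ} (hf0 : ∀ x, 0 ≤ f x) (hfm : Measurable f)
    (hf1 : ∫ x, f x = 1) (hfBV : eVariationOn f Set.univ ≠ ⊤) {E₁ E₂ : ℝ} (hE : E₁ ≤ E₂) :
    ∫⁻ ω, ENNReal.ofReal (specProj (hH ω) (Set.Icc E₁ E₂) j j).re
        ∂(Measure.pi fun _ : ι => volume.withDensity fun x => ENNReal.ofReal (f x)) ≤
      ENNReal.ofReal ((E₂ - E₁) * ((eVariationOn f Set.univ).toReal * ∑ i, |b i|)) := by
  set μ := Measure.pi fun _ : ι => volume.withDensity fun x => ENNReal.ofReal (f x) with hμ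
  set C := (eVariationOn f Set.univ).toReal * ∑ i, |b i| with hC
  have hC0 : 0 ≤ C := by positivity
  have hδ : ∀ δ : ℝ, 0 < δ → ENNReal.ofReal (2 * Real.arctan (1 / δ)) *
      ∫⁻ ω, ENNReal.ofReal (specProj (hH ω) (Set.Icc E₁ E₂) j j).re ∂μ ≤
        ENNReal.ofReal ((E₂ - E₁ + 2 * δ) * (Real.pi * C)) := by
    intro δ hδ
    have hε : 0 < δ ^ 2 := by positivity
    have hherm : ∀ (ω : ι → ℝ) (E : ℝ), (H ω - diagonal fun _ => (E : ℂ)).IsHermitian :=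
      fun ω E => (hH ω).sub_ofReal_diagonal fun _ => E
    set F : (ι → ℝ) → ℝ → ENNReal := fun ω E => ENNReal.ofReal
      ((H ω - diagonal (fun _ => (E : ℂ)) -
        diagonal fun _ => Complex.I * ((δ ^ 2 : ℝ) : ℂ) : Matrix n n ℂ)⁻¹ j j).im with hF
    have hFm : Measurable fun p : (ι → ℝ) × ℝ => F p.1 p.2 := by
      refine (ENNReal.continuous_ofReal.comp (Complex.continuous_im.comp
        (Continuous.matrix_inv_apply (A := fun p : (ι → ℝ) × ℝ =>
          H p.1 - diagonal (fun _ => (p.2 : ℂ)) - diagonal fun _ => Complex.I * ((δ ^ 2 : ℝ) : ℂ))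
          ?_ (fun p => (hherm p.1 p.2).isUnit_det_sub_diagonal fun _ => hε) j j))).measurable
      refine ((hcont.comp continuous_fst).sub (Continuous.matrix_diagonal ?_)).sub continuous_const
      exact continuous_pi fun _ => Complex.continuous_ofReal.comp continuous_snd
    have hFE : ∀ E, ∫⁻ ω, F ω E ∂μ ≤ ENNReal.ofReal Real.pi * ENNReal.ofReal C := by
      intro E
      refine lintegral_pi_withDensity_le_of_lintegral_line_le
        (hFm.comp (by fun_prop : Measurable fun ω : ι → ℝ => (ω, E)))
        (M := ENNReal.ofReal (δ ^ 2)⁻¹) ENNReal.ofReal_ne_top ENNReal.ofReal_ne_top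
        (fun ω => ENNReal.ofReal_le_ofReal
          ((hherm ω E).inv_sub_diagonal_im (fun _ => hε) j).2)
        b (fun ω => ?_) hf0 hfm hf1 hfBV
      refine le_trans (le_of_eq (lintegral_congr fun s => ?_))
        (lintegral_inv_sub_smul_le (hherm ω E) hW hε hj)
      simp only [hF, hline, Function.comp_apply]
      rw [sub_right_comm (H ω)]
    have : IsProbabilityMeasure (volume.withDensity fun x => ENNReal.ofReal (f x)) := by
      constructor
      rw [withDensity_apply _ MeasurableSet.univ, setLIntegral_univ,
        ← ofReal_integral_eq_lintegral_ofReal (.of_integral_ne_zero (by simp [hf1]))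
          (Filter.Eventually.of_forall hf0), hf1, ENNReal.ofReal_one]
    have harctan : 0 ≤ 2 * Real.arctan (1 / δ) := by
      have : 0 ≤ Real.arctan (1 / δ) := Real.arctan_nonneg.2 (by positivity)
      positivity
    calc _ = ∫⁻ ω, ENNReal.ofReal
            (2 * Real.arctan (1 / δ) * (specProj (hH ω) (Set.Icc E₁ E₂) j j).re) ∂μ := by
          rw [← lintegral_const_mul' _ _ ENNReal.ofReal_ne_top]
          exact lintegral_congr fun ω => (ENNReal.ofReal_mul harctan).symm
      _ ≤ ∫⁻ ω, ∫⁻ E in Set.Icc (E₁ - δ) (E₂ + δ), F ω E ∂volume ∂μ :=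
          lintegral_mono fun ω => two_arctan_mul_specProj_le (hH ω) hE j hδ
      _ = ∫⁻ E in Set.Icc (E₁ - δ) (E₂ + δ), ∫⁻ ω, F ω E ∂μ :=
          lintegral_lintegral_swap hFm.aemeasurable
      _ ≤ ∫⁻ _ in Set.Icc (E₁ - δ) (E₂ + δ), ENNReal.ofReal Real.pi * ENNReal.ofReal C :=
          lintegral_mono hFE
      _ = _ := by
          rw [setLIntegral_const, Real.volume_Icc, ← ENNReal.ofReal_mul Real.pi_pos.le,
            ← ENNReal.ofReal_mul (by positivity)]
          ring_nf
  have hlim : Filter.Tendsto (fun δ : ℝ => 2 * Real.arctan (1 / δ)) (nhdsWithin 0 (Set.Ioi 0))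
      (nhds Real.pi) := by
    have h1 : Filter.Tendsto (fun δ : ℝ => 1 / δ) (nhdsWithin 0 (Set.Ioi 0)) Filter.atTop := by
      simpa using tendsto_inv_nhdsGT_zero (𝕜 := ℝ)
    have h2 := (((Real.tendsto_arctan_atTop).mono_right nhdsWithin_le_nhds).comp h1).const_mul 2
    rwa [mul_div_cancel₀ Real.pi two_ne_zero] at h2
  have hlim2 : Filter.Tendsto (fun δ : ℝ => (E₂ - E₁ + 2 * δ) * (Real.pi * C))
      (nhdsWithin 0 (Set.Ioi 0)) (nhds ((E₂ - E₁) * (Real.pi * C))) := by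
    refine tendsto_nhdsWithin_of_tendsto_nhds ?_
    have : Continuous fun δ : ℝ => (E₂ - E₁ + 2 * δ) * (Real.pi * C) := by fun_prop
    simpa using this.tendsto 0
  have hfinal := le_of_tendsto_of_tendsto
    (ENNReal.Tendsto.mul_const (ENNReal.tendsto_ofReal hlim)
      (Or.inl (ENNReal.ofReal_pos.2 Real.pi_pos).ne'))
    (ENNReal.tendsto_ofReal hlim2) (eventually_nhdsWithin_of_forall hδ)
  rw [show (E₂ - E₁) * (Real.pi * C) = Real.pi * ((E₂ - E₁) * C) by ring,
    ENNReal.ofReal_mul Real.pi_pos.le] at hfinal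
  exact (ENNReal.mul_le_mul_iff_right (ENNReal.ofReal_pos.2 Real.pi_pos).ne'
    ENNReal.ofReal_ne_top).1 hfinal

lemma star_dotProduct_chi_mul_mulVec (P : Matrix n n ℂ) (j : n) (φ : n → ℂ) :
    (star φ ⬝ᵥ (chi j * P * chi j) *ᵥ φ).re = ‖φ j‖ ^ 2 * (P j j).re := by
  have h1 : (chi j * P * chi j) *ᵥ φ = Pi.single j (P j j * φ j) := by
    ext i
    rw [mulVec, dotProduct]
    rcases eq_or_ne i j with rfl | hi
    · simp [chi, Matrix.diagonal_mul, Matrix.mul_diagonal]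
    · simp [chi, Matrix.diagonal_mul, Matrix.mul_diagonal, hi]
  rw [h1, dotProduct_single, Pi.star_apply, mul_comm (P j j), ← mul_assoc, Complex.star_def,
    Complex.conj_mul', ← Complex.ofReal_pow, Complex.re_ofReal_mul]

end Wegner
/-- **Proposition 2 of the paper**: if the coefficient matrix `A_Λ` (which coincides with
the Laurent matrix `α_{j-k}` for `j ∈ Q_{l+r}`, `k ∈ Q_{l+R}`) is invertible with inverse
`B_Λ`, then for every `j ∈ Q_l` and every normalized `φ ∈ ℓ²(Q_l)`,
`E{⟨φ, χ_j P_ω^l(I) χ_j φ⟩} ≤ |I| ⬝ ‖f‖_BV ⬝ ‖B_Λ‖₁`,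
where `‖B_Λ‖₁` is the column sum norm of `B_Λ`, `‖f‖_BV` the total variation of the
density `f` of the i.i.d. coupling constants `(ω_k)_{k ∈ Q_{l+R}}` (those are all that
influence `H_ω^l`, since `supp u ⊆ Λ_R`), and the expectation is the integral with
respect to the product of the measures `f dx`. -/
theorem wegner_local_estimate
    (d : ℕ) (hd : 1 ≤ d) (l r R : ℕ)
    -- the single site potential of generalised step function form
    (v : (Fin d → ℤ) → ℝ) (hv : ∀ x, v x ≥ if x = 0 then 1 else 0)
    (hvsupp : ∀ x : Fin d → ℤ, v x ≠ 0 → ∀ i, |x i| ≤ (r : ℤ))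
    (α : (Fin d → ℤ) → ℝ) (hαfin : (Function.support α).Finite)
    (u : (Fin d → ℤ) → ℝ) (hu : ∀ x, u x = ∑ᶠ k : Fin d → ℤ, α k * v (x - k))
    (hR : ∀ x : Fin d → ℤ, u x ≠ 0 → ∀ i, |x i| ≤ (R : ℤ))
    -- the bounded background potential
    (Vper : (Fin d → ℤ) → ℝ) (hVbdd : ∃ C, ∀ x, |Vper x| ≤ C)
    -- the density of the i.i.d. coupling constants: compactly supported, of bounded variation
    (f : ℝ → ℝ) (hf0 : ∀ x, 0 ≤ f x) (hfm : Measurable f) (hfc : HasCompactSupport f)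
    (hf1 : ∫ x, f x = 1) (hfBV : eVariationOn f Set.univ ≠ ⊤)
    -- the invertible matrix `A_Λ` reproducing `α_{j-k}` on `Q_{l+r} × Q_{l+R}`, and its inverse
    (AΛ BΛ : Matrix (DCube d (l + R)) (DCube d (l + R)) ℝ)
    (hA : ∀ j k : DCube d (l + R), (∀ i, |(j i : ℤ)| ≤ ((l : ℤ) + r)) →
      AΛ j k = α (j.emb - k.emb))
    (hAB : AΛ * BΛ = 1) (hBA : BΛ * AΛ = 1)
    -- the random Hamiltonian restricted to the cube `Q_l` is Hermitian
    (hherm : ∀ V : (Fin d → ℤ) → ℝ, (schrodinger d l V).IsHermitian)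
    (E₁ E₂ : ℝ) (hE : E₁ ≤ E₂)
    (j : DCube d l) (φ : DCube d l → ℂ) (hφ : ∑ q, ‖φ q‖ ^ 2 = 1) :
    ∫ ω : DCube d (l + R) → ℝ,
        (star φ ⬝ᵥ (chi j * specProj
            (hherm fun x => Vper x + ∑ k : DCube d (l + R), ω k * u (x - k.emb))
            (Set.Icc E₁ E₂) * chi j) *ᵥ φ).re
        ∂(Measure.pi fun _ : DCube d (l + R) =>
            volume.withDensity fun x => ENNReal.ofReal (f x)) ≤
      (E₂ - E₁) * (eVariationOn f Set.univ).toReal *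
        (⨆ k : DCube d (l + R), ∑ j' : DCube d (l + R), |BΛ j' k|) := by

  classical
  have hu' : ∀ x, ∑ᶠ k, α k * v (x - k) ≠ 0 → ∀ i, |x i| ≤ (R : ℤ) := fun x hx =>
    hR x (by rwa [hu])
  obtain ⟨j', hj'⟩ : ∃ j' : DCube d (l + R), j'.emb = j.emb :=
    DCube.exists_emb_eq fun i => (abs_le.2 (j i).2).trans (by push_cast; omega)
  have hconv : ∀ x : DCube d l, ∑ k, BΛ k j' * u (x.emb - k.emb) = v (x.emb - j.emb) := by
    intro x
    simp only [hu]
    rw [← hj']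
    exact sum_inv_mul_convolution hvsupp
      (abs_le_of_support_convolution hαfin hvsupp hu' hA hAB) hA hAB x j'
  set V : (DCube d (l + R) → ℝ) → (Fin d → ℤ) → ℝ :=
    fun ω x => Vper x + ∑ k, ω k * u (x - k.emb) with hV
  have hcont : Continuous fun ω => schrodinger d l (V ω) :=
    continuous_const.add (Continuous.matrix_diagonal (continuous_pi fun q =>
      Complex.continuous_ofReal.comp (by fun_prop)))
  have hline : ∀ (ω : DCube d (l + R) → ℝ) (s : ℝ),
      schrodinger d l (V (ω - s • fun k => BΛ k j')) = schrodinger d l (V ω) -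
        diagonal fun q => ((s * v (q.emb - j.emb) : ℝ) : ℂ) := by
    intro ω s
    rw [schrodinger, schrodinger, add_sub_assoc, diagonal_sub]
    congr 2
    ext q
    rw [← hconv q, ← Complex.ofReal_sub, hV]
    simp only [Pi.sub_apply, Pi.smul_apply, smul_eq_mul, sub_mul, Finset.sum_sub_distrib,
      Finset.mul_sum, mul_assoc]
    ring_nf
  have hv0 : ∀ x, 0 ≤ v x := fun x => le_trans (by split_ifs <;> norm_num) (hv x)
  have hmain := lintegral_specProj_apply_self_le (fun ω => hherm (V ω)) hcont
    (W := fun q => v (q.emb - j.emb)) (fun q => hv0 _) (j := j) (by simpa using hv 0) hline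
    hf0 hfm hf1 hfBV hE
  have hφj : ‖φ j‖ ^ 2 ≤ 1 :=
    hφ ▸ Finset.single_le_sum (fun q _ => sq_nonneg ‖φ q‖) (Finset.mem_univ j)
  have hcol : ∑ k, |BΛ k j'| ≤ ⨆ k, ∑ j', |BΛ j' k| :=
    le_ciSup (f := fun k => ∑ j', |BΛ j' k|) (Set.finite_range _).bddAbove j'
  have hbound : ∫ ω : DCube d (l + R) → ℝ,
      (star φ ⬝ᵥ (chi j * specProj (hherm (V ω)) (Set.Icc E₁ E₂) * chi j) *ᵥ φ).re
        ∂(Measure.pi fun _ : DCube d (l + R) =>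
            volume.withDensity fun x => ENNReal.ofReal (f x)) ≤
      (E₂ - E₁) * ((eVariationOn f Set.univ).toReal * ∑ k, |BΛ k j'|) := by
    refine (le_abs_self _).trans ?_
    rw [← ENNReal.ofReal_le_ofReal_iff
      (mul_nonneg (sub_nonneg.2 hE) (by positivity)), ← Real.enorm_eq_ofReal_abs]
    refine (enorm_integral_le_lintegral_enorm _).trans
      ((lintegral_mono fun ω => ?_).trans hmain)
    have hP := specProj_apply_self_re_nonneg (hherm (V ω)) (Set.Icc E₁ E₂) j
    rw [star_dotProduct_chi_mul_mulVec, Real.enorm_of_nonneg (by positivity)]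
    exact ENNReal.ofReal_le_ofReal (mul_le_of_le_one_left hP hφj)
  refine hbound.trans ?_
  rw [mul_assoc]
  gcongr

end
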